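/- Let p > 3 be a prime. Then Σ_{1 ≤ k ≤ (p²-1)/2, p∤k} 1/k² ≡ 0 (mod p²) and Σ_{1 ≤ k ≤ p²-1, p∤k} 1/k² ≡ 0 (mod p²). -/

import Mathlib

open Finset

/-- Generalized binomial coefficient `C(a,k) = a(a-1)⋯(a-k+1)/k!` for a rational `a`. -/
noncomputable def gchoose (a : ℚ) (k : ℕ) : ℚ :=
  (∏ j ∈ Finset.range k, (a - j)) / (Nat.factorial k : ℚ)

/-- The harmonic number `H_k = ∑_{j=1}^k 1/j`. -/
def harm (k : ℕ) : ℚ := ∑ j ∈ Finset.range k, (1 : ℚ) / (j + 1)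

/-- The second-order harmonic number `H_k^{(2)} = ∑_{j=1}^k 1/j²`. -/
def harm2 (k : ℕ) : ℚ := ∑ j ∈ Finset.range k, (1 : ℚ) / (j + 1) ^ 2

/-- `x ≡ y (mod p^m)` for rationals: the p-adic valuation of `x - y` is at least `m`
(with the convention that the valuation of `0` is `+∞`). -/
def CongrMod (p m : ℕ) (x y : ℚ) : Prop :=
  x = y ∨ (m : ℤ) ≤ padicValRat p (x - y)

/-- The Bernoulli polynomial `B_n` evaluated at a rational `x`. -/
noncomputable def bpoly (n : ℕ) (x : ℚ) : ℚ := (Polynomial.bernoulli n).eval x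

/-- The Euler polynomial `E_n` evaluated at a rational `x`, via
`E_n(x) = (2/(n+1))·(B_{n+1}(x) − 2^{n+1}·B_{n+1}(x/2))`. -/
noncomputable def epoly (n : ℕ) (x : ℚ) : ℚ :=
  (2 / (n + 1 : ℚ)) * (bpoly (n + 1) x - 2 ^ (n + 1) * bpoly (n + 1) (x / 2))

/-- The Euler number `E_n = 2^n · E_n(1/2)`. -/
noncomputable def eulerNum (n : ℕ) : ℚ := 2 ^ n * epoly n (1 / 2)

/-- A sum of inverse squares of natural numbers prime to `p` is a fraction whose reduction modulo
`p ^ m` is computed termwise. -/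
lemma exists_int_div_eq_sum_inv_sq {p : ℕ} (hp : p.Prime) (m : ℕ) (s : Finset ℕ)
    (hs : ∀ k ∈ s, ¬ p ∣ k) :
    ∃ N D : ℤ, ¬ (p : ℤ) ∣ D ∧ ∑ k ∈ s, (1 : ℚ) / (k : ℚ) ^ 2 = N / D ∧
      (N : ZMod (p ^ m)) = D * ∑ k ∈ s, Ring.inverse (k : ZMod (p ^ m)) ^ 2 := by
  induction s using Finset.induction_on with
  | empty => exact ⟨0, 1, by simpa [Int.natCast_dvd] using hp.one_lt.ne', by simp, by simp⟩
  | insert a s ha ih =>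
    obtain ⟨N, D, hD, hsum, hmod⟩ := ih fun k hk => hs k (mem_insert_of_mem hk)
    have hpa : ¬ p ∣ a := hs a (mem_insert_self a s)
    have hpa' : ¬ (p : ℤ) ∣ (a : ℤ) := by exact_mod_cast hpa
    have ha0 : (a : ℚ) ≠ 0 := by
      rintro h
      exact hpa ((Nat.cast_eq_zero.mp h) ▸ dvd_zero p)
    have hD0 : (D : ℚ) ≠ 0 := by
      rintro h
      exact hD ((Int.cast_eq_zero.mp h) ▸ dvd_zero _)
    have hunit : IsUnit (a : ZMod (p ^ m)) :=
      (ZMod.isUnit_iff_coprime a (p ^ m)).2 (((hp.coprime_iff_not_dvd.2 hpa).pow_left m).symm)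
    have hinv := Ring.mul_inverse_cancel _ hunit
    have hpr : Prime (p : ℤ) := Nat.prime_iff_prime_int.mp hp
    refine ⟨D + N * a ^ 2, D * a ^ 2, ?_, ?_, ?_⟩
    · exact fun h => (hpr.dvd_or_dvd h).elim hD fun h => hpa' (hpr.dvd_of_dvd_pow h)
    · rw [sum_insert ha, hsum]
      push_cast
      field_simp
    · rw [sum_insert ha]
      push_cast
      rw [hmod]
      linear_combination
        (-(D : ZMod (p ^ m)) * (a * Ring.inverse (a : ZMod (p ^ m)) + 1)) * hinv

lemma congrMod_sum_inv_sq_zero {p : ℕ} (hp : p.Prime) (m : ℕ) (s : Finset ℕ)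
    (hs : ∀ k ∈ s, ¬ p ∣ k) (h : ∑ k ∈ s, Ring.inverse (k : ZMod (p ^ m)) ^ 2 = 0) :
    CongrMod p m (∑ k ∈ s, (1 : ℚ) / (k : ℚ) ^ 2) 0 := by
  have := Fact.mk hp
  obtain ⟨N, D, hD, hsum, hmod⟩ := exists_int_div_eq_sum_inv_sq hp m s hs
  rw [h, mul_zero, ZMod.intCast_zmod_eq_zero_iff_dvd] at hmod
  rw [CongrMod, sub_zero, hsum]
  by_cases hN : N = 0
  · simp [hN]
  right
  have hD0 : D ≠ 0 := fun h => hD (h ▸ dvd_zero _)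
  rw [padicValRat.div (by exact_mod_cast hN) (by exact_mod_cast hD0), padicValRat.of_int,
    padicValRat.of_int, padicValInt.eq_zero_of_not_dvd hD]
  have : m ≤ padicValInt p N := by
    rw [Nat.cast_pow] at hmod
    exact ((padicValInt_dvd_iff m N).1 hmod).resolve_left hN
  simpa using this

lemma sum_range_natCast_zmod {M : Type*} [AddCommMonoid M] (n : ℕ) [NeZero n] (f : ZMod n → M) :
    ∑ k ∈ range n, f k = ∑ x, f x :=
  sum_nbij' (fun k => (k : ZMod n)) ZMod.val (by simp) (by simp [ZMod.val_lt])
    (fun k hk => ZMod.val_cast_of_lt (mem_range.1 hk)) (by simp) (by simp)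

lemma sum_inverse_sq_eq_zero {R : Type*} [CommRing R] [Fintype R] (h2 : IsUnit (2 : R))
    (h3 : IsUnit (3 : R)) : ∑ x : R, Ring.inverse x ^ 2 = 0 := by
  have h : ∑ x : R, Ring.inverse x ^ 2 = Ring.inverse 2 ^ 2 * ∑ x : R, Ring.inverse x ^ 2 := by
    rw [mul_sum, ← Equiv.sum_comp (Units.mulLeft h2.unit)]
    refine sum_congr rfl fun x _ => ?_
    simp [Ring.mul_inverse_rev, mul_pow, mul_comm]
  have hinv := Ring.mul_inverse_cancel _ h2
  refine (h3.mul_right_eq_zero).1 ?_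
  linear_combination 4 * h + (2 * Ring.inverse 2 + 1) * (∑ x : R, Ring.inverse x ^ 2) * hinv

lemma sum_range_two_mul_add_one_of_symm {M : Type*} [AddCommMonoid M] (m : ℕ) (g : ℕ → M)
    (h0 : g 0 = 0) (hg : ∀ k ≤ 2 * m + 1, g (2 * m + 1 - k) = g k) :
    ∑ k ∈ range (2 * m + 1), g k = 2 • ∑ k ∈ Icc 1 m, g k := by
  have hIcc : ∑ k ∈ Icc 1 m, g k = ∑ k ∈ range m, g (k + 1) := by
    rw [range_eq_Ico, sum_Ico_add' g 0 m 1]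
    rfl
  rw [sum_range_succ', h0, add_zero, two_mul, sum_range_add, hIcc, two_nsmul]
  congr 1
  rw [← sum_range_reflect (fun k => g (k + 1)) m]
  refine sum_congr rfl fun k hk => ?_
  have hk := mem_range.1 hk
  rw [← hg (m + k + 1) (by lia)]
  congr 1
  lia

lemma sum_filter_not_dvd_inverse_sq {p m : ℕ} (hp : p.Prime) (hm : m ≠ 0) (s : Finset ℕ) :
    ∑ k ∈ s.filter (fun k => ¬ p ∣ k), Ring.inverse (k : ZMod (p ^ m)) ^ 2 =
      ∑ k ∈ s, Ring.inverse (k : ZMod (p ^ m)) ^ 2 := by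
  refine sum_filter_of_ne fun k _ hk hpk => hk ?_
  rw [Ring.inverse_non_unit, zero_pow two_ne_zero]
  rw [ZMod.isUnit_iff_coprime, Nat.coprime_pow_right_iff (Nat.pos_of_ne_zero hm), Nat.coprime_comm,
    hp.coprime_iff_not_dvd]
  exact not_not_intro hpk

theorem stmt_19 (p : ℕ) (hp : p.Prime) (hp3 : 3 < p) :
    CongrMod p 2
      (∑ k ∈ (Finset.Icc 1 ((p ^ 2 - 1) / 2)).filter (fun k => ¬ (p ∣ k)),
        (1 : ℚ) / (k : ℚ) ^ 2) 0 ∧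
    CongrMod p 2
      (∑ k ∈ (Finset.Icc 1 (p ^ 2 - 1)).filter (fun k => ¬ (p ∣ k)),
        (1 : ℚ) / (k : ℚ) ^ 2) 0 := by
  have hodd : Odd (p ^ 2) := (hp.odd_of_ne_two (by lia)).pow
  obtain ⟨m, hm⟩ := hodd
  have : NeZero (p ^ 2) := ⟨by lia⟩
  have hunit : ∀ q : ℕ, q.Prime → q < p → IsUnit (q : ZMod (p ^ 2)) := fun q hq hqp =>
    (ZMod.isUnit_iff_coprime q (p ^ 2)).2 (((Nat.coprime_primes hq hp).2 hqp.ne).pow_right 2)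
  have h2 : IsUnit (2 : ZMod (p ^ 2)) := by exact_mod_cast hunit 2 Nat.prime_two (by lia)
  have h3 : IsUnit (3 : ZMod (p ^ 2)) := by exact_mod_cast hunit 3 Nat.prime_three hp3
  let g : ℕ → ZMod (p ^ 2) := fun k => Ring.inverse (k : ZMod (p ^ 2)) ^ 2
  have hg0 : g 0 = 0 := by
    have : Fact (1 < p ^ 2) := ⟨Nat.one_lt_pow two_ne_zero hp.one_lt⟩
    simp [g]
  have hfull : ∑ k ∈ range (p ^ 2), g k = 0 :=
    (sum_range_natCast_zmod (p ^ 2) fun x => Ring.inverse x ^ 2).trans (sum_inverse_sq_eq_zero h2 h3)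
  have hsymm : ∀ k ≤ 2 * m + 1, g (2 * m + 1 - k) = g k := by
    intro k hk
    simp only [g]
    rw [← hm] at hk ⊢
    rw [Nat.cast_sub hk, ZMod.natCast_self, zero_sub, Ring.inverse_pow, neg_sq, ← Ring.inverse_pow]
  refine ⟨congrMod_sum_inv_sq_zero hp 2 _ (fun k hk => (mem_filter.1 hk).2) ?_,
    congrMod_sum_inv_sq_zero hp 2 _ (fun k hk => (mem_filter.1 hk).2) ?_⟩ <;>
    rw [sum_filter_not_dvd_inverse_sq hp two_ne_zero]
  · have h := sum_range_two_mul_add_one_of_symm m g hg0 hsymm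
    rw [← hm, hfull, nsmul_eq_mul, Nat.cast_ofNat, eq_comm, h2.mul_right_eq_zero] at h
    rwa [show (p ^ 2 - 1) / 2 = m by lia]
  · have hrange : range (p ^ 2) = insert 0 (Icc 1 (p ^ 2 - 1)) := by
      ext k
      simp only [mem_range, mem_insert, mem_Icc]
      lia
    rwa [hrange, sum_insert (by simp), hg0, zero_add] at hfull
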